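/- In the setting of the augmented Lagrangian L_ρ, suppose F is differentiable, AAᵀ is positive definite with smallest eigenvalue λ > 0, G ∈ ℝ^{d×d}, and η, ρ > 0. Suppose x, x⁺, v ∈ ℝ^d and z ∈ ℝ^p satisfy Aᵀz = v + (1/η)G(x⁺ − x). Then for every y = (y_1,…,y_m) ∈ (ℝ^l)^m, L_ρ(x⁺, y, z) ≥ F(x⁺) + Σ_{j=1}^m g_j(y_j) − (2/(λρ))‖v − ∇F(x)‖² − (2/(λρ))‖∇F(x)‖² − (2‖G‖²/(λη²ρ))‖x⁺ − x‖² + (ρ/8)‖Ax⁺ + Σ_{j=1}^m B_j y_j − c‖². -/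

import Mathlib

open ContinuousLinearMap
open scoped RealInnerProductSpace

/-- The augmented Lagrangian `L_ρ(x, y, z)`. -/
noncomputable def augLag {d l p m : ℕ}
    (F : EuclideanSpace ℝ (Fin d) → ℝ)
    (g : Fin m → EuclideanSpace ℝ (Fin l) → ℝ)
    (A : EuclideanSpace ℝ (Fin d) →L[ℝ] EuclideanSpace ℝ (Fin p))
    (B : Fin m → EuclideanSpace ℝ (Fin l) →L[ℝ] EuclideanSpace ℝ (Fin p))
    (c : EuclideanSpace ℝ (Fin p)) (ρ : ℝ)
    (x : EuclideanSpace ℝ (Fin d)) (y : Fin m → EuclideanSpace ℝ (Fin l))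
    (z : EuclideanSpace ℝ (Fin p)) : ℝ :=
  F x + ∑ j, g j (y j) - ⟪z, A x + ∑ j, B j (y j) - c⟫ +
    (ρ / 2) * ‖A x + ∑ j, B j (y j) - c‖ ^ 2

/-- The quadratic form of a symmetric operator on a finite-dimensional real inner product space is
bounded below by the infimum of its spectrum. -/
theorem sInf_spectrum_mul_norm_sq_le_inner {E : Type*} [NormedAddCommGroup E]
    [InnerProductSpace ℝ E] [FiniteDimensional ℝ E] (T : E →L[ℝ] E)
    (hT : (T : E →ₗ[ℝ] E).IsSymmetric) (x : E) :
    sInf (spectrum ℝ T) * ‖x‖ ^ 2 ≤ ⟪T x, x⟫ := by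
  have := FiniteDimensional.complete ℝ E
  rcases eq_or_ne x 0 with rfl | hx
  · simp
  have : Nontrivial E := ⟨x, 0, hx⟩
  have hmem := hT.hasEigenvalue_iInf_of_finiteDimensional.mem_spectrum
  have hbound : BddBelow (Set.range fun u : {u : E // u ≠ 0} =>
      ⟪T (u : E), (u : E)⟫ / ‖(u : E)‖ ^ 2) := by
    refine ⟨-‖T‖, ?_⟩
    rintro _ ⟨⟨u, hu⟩, rfl⟩
    have hu' : 0 < ‖u‖ := norm_pos_iff.mpr hu
    rw [le_div_iff₀ (by positivity)]
    nlinarith [neg_le_of_abs_le (abs_real_inner_le_norm (T u) u), T.le_opNorm u]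
  have hspec : (⨅ u : {u : E // u ≠ 0}, ⟪T (u : E), (u : E)⟫ / ‖(u : E)‖ ^ 2) ∈
      spectrum ℝ T := by
    rw [ContinuousLinearMap.spectrum_eq]
    exact hmem
  rw [← le_div_iff₀ (by have := norm_pos_iff.mpr hx; positivity)]
  exact (csInf_le (spectrum.isCompact T).bddBelow hspec).trans (ciInf_le hbound ⟨x, hx⟩)

/-- The squared norm of the adjoint of `A` is bounded below through the smallest spectral value
of `A A*`. -/
theorem sInf_spectrum_mul_norm_sq_le_norm_adjoint_sq {E H : Type*} [NormedAddCommGroup E]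
    [InnerProductSpace ℝ E] [CompleteSpace E] [NormedAddCommGroup H] [InnerProductSpace ℝ H]
    [FiniteDimensional ℝ H] [CompleteSpace H] (A : E →L[ℝ] H) (z : H) :
    sInf (spectrum ℝ (A ∘L adjoint A)) * ‖z‖ ^ 2 ≤ ‖adjoint A z‖ ^ 2 := by
  refine (sInf_spectrum_mul_norm_sq_le_inner _
    (isPositive_self_comp_adjoint A).isSymmetric z).trans_eq ?_
  rw [comp_apply, ← adjoint_inner_right, real_inner_self_eq_norm_sq]

theorem norm_add_add_sq_le {E : Type*} [SeminormedAddCommGroup E] (a b c : E) :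
    ‖a + b + c‖ ^ 2 ≤ 3 * (‖a‖ ^ 2 + ‖b‖ ^ 2 + ‖c‖ ^ 2) := by
  nlinarith [norm_add₃_le (a := a) (b := b) (c := c), norm_nonneg (a + b + c),
    sq_nonneg (‖a‖ - ‖b‖), sq_nonneg (‖b‖ - ‖c‖), sq_nonneg (‖a‖ - ‖c‖)]

/-- Lower bound on the augmented Lagrangian at the new iterate,
where `lam` is the smallest eigenvalue of the positive definite matrix `A Aᵀ`. -/
theorem admm_augLag_lower_bound {d l p m : ℕ}
    (F : EuclideanSpace ℝ (Fin d) → ℝ)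
    (g : Fin m → EuclideanSpace ℝ (Fin l) → ℝ)
    (A : EuclideanSpace ℝ (Fin d) →L[ℝ] EuclideanSpace ℝ (Fin p))
    (B : Fin m → EuclideanSpace ℝ (Fin l) →L[ℝ] EuclideanSpace ℝ (Fin p))
    (c : EuclideanSpace ℝ (Fin p))
    (hF : Differentiable ℝ F)
    (lam : ℝ) (hlam_pos : 0 < lam)
    (hlam : lam = sInf (spectrum ℝ (A ∘L adjoint A)))
    (G : EuclideanSpace ℝ (Fin d) →L[ℝ] EuclideanSpace ℝ (Fin d))
    (η ρ : ℝ) (hη : 0 < η) (hρ : 0 < ρ)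
    (x xp v : EuclideanSpace ℝ (Fin d)) (z : EuclideanSpace ℝ (Fin p))
    (hz : adjoint A z = v + η⁻¹ • G (xp - x))
    (y : Fin m → EuclideanSpace ℝ (Fin l)) :
    F xp + ∑ j, g j (y j) - (2 / (lam * ρ)) * ‖v - gradient F x‖ ^ 2
        - (2 / (lam * ρ)) * ‖gradient F x‖ ^ 2
        - (2 * ‖G‖ ^ 2 / (lam * η ^ 2 * ρ)) * ‖xp - x‖ ^ 2
        + (ρ / 8) * ‖A xp + ∑ j, B j (y j) - c‖ ^ 2 ≤
      augLag F g A B c ρ xp y z := by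
  set r := A xp + ∑ j, B j (y j) - c
  have hz_sq : lam * ‖z‖ ^ 2 ≤
      3 * (‖v - gradient F x‖ ^ 2 + ‖gradient F x‖ ^ 2 + ‖G‖ ^ 2 / η ^ 2 * ‖xp - x‖ ^ 2) :=
    calc lam * ‖z‖ ^ 2 ≤ ‖adjoint A z‖ ^ 2 :=
          hlam ▸ sInf_spectrum_mul_norm_sq_le_norm_adjoint_sq A z
      _ = ‖v - gradient F x + gradient F x + η⁻¹ • G (xp - x)‖ ^ 2 := by
          rw [hz, sub_add_cancel]
      _ ≤ 3 * (‖v - gradient F x‖ ^ 2 + ‖gradient F x‖ ^ 2 + ‖η⁻¹ • G (xp - x)‖ ^ 2) :=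
          norm_add_add_sq_le _ _ _
      _ ≤ _ := by
          have hG : ‖η⁻¹ • G (xp - x)‖ ^ 2 ≤ (η⁻¹ * (‖G‖ * ‖xp - x‖)) ^ 2 := by
            rw [norm_smul, Real.norm_of_nonneg (inv_nonneg.mpr hη.le)]
            gcongr
            exact G.le_opNorm _
          have hG' : (η⁻¹ * (‖G‖ * ‖xp - x‖)) ^ 2 = ‖G‖ ^ 2 / η ^ 2 * ‖xp - x‖ ^ 2 := by
            field_simp
          rw [hG'] at hG
          gcongr
  have hz_div : 2 / (3 * ρ) * ‖z‖ ^ 2 ≤ 2 / (lam * ρ) * ‖v - gradient F x‖ ^ 2 +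
      2 / (lam * ρ) * ‖gradient F x‖ ^ 2 +
      2 * ‖G‖ ^ 2 / (lam * η ^ 2 * ρ) * ‖xp - x‖ ^ 2 :=
    calc 2 / (3 * ρ) * ‖z‖ ^ 2 = 2 / (3 * lam * ρ) * (lam * ‖z‖ ^ 2) := by field_simp
      _ ≤ 2 / (3 * lam * ρ) * (3 * (‖v - gradient F x‖ ^ 2 + ‖gradient F x‖ ^ 2 +
            ‖G‖ ^ 2 / η ^ 2 * ‖xp - x‖ ^ 2)) := by gcongr
      _ = _ := by field_simp
  have hinner : ⟪z, r⟫ ≤ 2 / (3 * ρ) * ‖z‖ ^ 2 + 3 * ρ / 8 * ‖r‖ ^ 2 := by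
    have hsq : 2 / (3 * ρ) * ‖z‖ ^ 2 + 3 * ρ / 8 * ‖r‖ ^ 2 - ‖z‖ * ‖r‖ =
        2 / (3 * ρ) * (‖z‖ - 3 * ρ / 4 * ‖r‖) ^ 2 := by
      field_simp
      ring
    have hnonneg : 0 ≤ 2 / (3 * ρ) * (‖z‖ - 3 * ρ / 4 * ‖r‖) ^ 2 := by positivity
    linarith [real_inner_le_norm z r]
  change _ ≤ F xp + ∑ j, g j (y j) - ⟪z, r⟫ + (ρ / 2) * ‖r‖ ^ 2
  linarith
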